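/- arXiv:math/9911185 — 3 statements merged into one kernel-verified Lean document; each statement's English description precedes it below -/
import Mathlib

section
/- Let d ≥ 1 and let G be a subgroup of the group of bijective isometries of Euclidean space ℝ^d. Suppose that the set V = {v ∈ ℝ^d : the translation x ↦ x + v belongs to G} spans ℝ^d as a real vector space. Then every element g of G that commutes with every translation belonging to G is itself a translation, i.e. there exists w ∈ ℝ^d with g x = x + w for all x. In particular the translations in G form a maximal abelian subgroup of G. -/
/-- Let `d ≥ 1` and `G` a subgroup of the group of bijective isometries of `ℝ^d`.
If the set of translation vectors of translations belonging to `G` spans `ℝ^d`,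
then every element of `G` commuting with every translation in `G` is itself a
translation. -/
theorem stmt0 (d : ℕ) (hd : 1 ≤ d)
    (G : Subgroup (EuclideanSpace ℝ (Fin d) ≃ᵢ EuclideanSpace ℝ (Fin d)))
    (hspan : Submodule.span ℝ {v : EuclideanSpace ℝ (Fin d) |
        ∃ h : EuclideanSpace ℝ (Fin d) ≃ᵢ EuclideanSpace ℝ (Fin d),
          h ∈ G ∧ ∀ x, h x = x + v} = ⊤)
    (g : EuclideanSpace ℝ (Fin d) ≃ᵢ EuclideanSpace ℝ (Fin d)) (hg : g ∈ G)
    (hcomm : ∀ h ∈ G, (∃ v, ∀ x, h x = x + v) → g * h = h * g) :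
    ∃ w : EuclideanSpace ℝ (Fin d), ∀ x, g x = x + w := by
  have hfix : ∀ x, g.toRealLinearIsometryEquiv x = x := by
    intro x
    have hx : x ∈ Submodule.span ℝ {v : EuclideanSpace ℝ (Fin d) |
        ∃ h : EuclideanSpace ℝ (Fin d) ≃ᵢ EuclideanSpace ℝ (Fin d),
          h ∈ G ∧ ∀ x, h x = x + v} := hspan ▸ Submodule.mem_top
    induction hx using Submodule.span_induction with
    | mem v hv =>
      obtain ⟨h, hG, hv⟩ := hv
      have key : g (h 0) = h (g 0) := DFunLike.congr_fun (hcomm h hG ⟨v, hv⟩) 0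
      rw [hv, hv, zero_add] at key
      rw [IsometryEquiv.toRealLinearIsometryEquiv_apply, key, add_sub_cancel_left]
    | zero => exact map_zero _
    | add x y _ _ hx hy => rw [map_add, hx, hy]
    | smul a x _ hx => rw [map_smul, hx]
  refine ⟨g 0, fun x => ?_⟩
  rw [← sub_eq_iff_eq_add, ← IsometryEquiv.toRealLinearIsometryEquiv_apply, hfix]
end

section
/- Let G be a subgroup of the group of bijective isometries of Euclidean 3-space ℝ³. Suppose there exist real numbers a, b, c, d, e, f such that G contains the isometries R and S given by R(x,y,z) = (a+y, b+z, c+x) and S(x,y,z) = (d+x, e−y, f−z). Then G contains an element of order exactly 3. -/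
/-- If a subgroup `G` of the isometry group of Euclidean 3-space contains isometries
`R(x,y,z) = (a+y, b+z, c+x)` and `S(x,y,z) = (d+x, e−y, f−z)` for some reals
`a, b, c, d, e, f`, then `G` contains an element of order exactly 3. -/
theorem stmt3 (G : Subgroup (EuclideanSpace ℝ (Fin 3) ≃ᵢ EuclideanSpace ℝ (Fin 3)))
    (h : ∃ (a b c d e f : ℝ)
        (R S : EuclideanSpace ℝ (Fin 3) ≃ᵢ EuclideanSpace ℝ (Fin 3)),
      R ∈ G ∧ S ∈ G ∧
      (∀ x : EuclideanSpace ℝ (Fin 3),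
        R x 0 = a + x 1 ∧ R x 1 = b + x 2 ∧ R x 2 = c + x 0) ∧
      (∀ x : EuclideanSpace ℝ (Fin 3),
        S x 0 = d + x 0 ∧ S x 1 = e - x 1 ∧ S x 2 = f - x 2)) :
    ∃ g ∈ G, g ^ 3 = 1 ∧ g ≠ 1 := by
  obtain ⟨a, b, c, d, e, f, R, S, hRG, hSG, hR, hS⟩ := h
  have hR3 : ∀ x, (R ^ 3) x 0 = (a + b + c) + x 0 ∧ (R ^ 3) x 1 = (a + b + c) + x 1 ∧
      (R ^ 3) x 2 = (a + b + c) + x 2 := by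
    intro x
    simp only [pow_succ, pow_zero, one_mul, IsometryEquiv.mul_apply, hR]
    refine ⟨?_, ?_, ?_⟩ <;> ring
  -- The conjugate `S R³ S⁻¹` is a translation cancelling the screw component of `R`.
  have hg : ∀ x, (R * (S * R ^ 3 * S⁻¹)) x 0 = x 1 - b - c ∧
      (R * (S * R ^ 3 * S⁻¹)) x 1 = x 2 - a - c ∧
      (R * (S * R ^ 3 * S⁻¹)) x 2 = x 0 + a + b + 2 * c := by
    intro x
    obtain ⟨y, rfl⟩ := S.surjective x
    simp only [IsometryEquiv.mul_apply, IsometryEquiv.inv_apply_self, hR, hS, hR3]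
    refine ⟨?_, ?_, ?_⟩ <;> ring
  refine ⟨R * (S * R ^ 3 * S⁻¹), G.mul_mem hRG
    (G.mul_mem (G.mul_mem hSG (G.pow_mem hRG 3)) (G.inv_mem hSG)), ?_, fun h1 => ?_⟩
  · generalize R * (S * R ^ 3 * S⁻¹) = g at hg
    ext x i
    simp only [pow_succ, pow_zero, one_mul, IsometryEquiv.mul_apply, IsometryEquiv.coe_one, id]
    fin_cases i <;> simp [hg] <;> ring
  · rw [h1] at hg
    have h0 := (hg 0).1
    have h2 := (hg (EuclideanSpace.single 0 1)).1
    simp at h0 h2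
    linarith
end

section
/- Let f : ℝ³ → ℝ³ be a bijective isometry of Euclidean 3-space whose image of D₃* equals D₃* (f is a symmetry of the body-centered cubic lattice). Then f permutes the cosets of D₃ in D₃*: for all u, v ∈ D₃*, if u − v ∈ D₃ then f(u) − f(v) ∈ D₃. -/
/-- The face-centered cubic lattice `D₃ = {(x,y,z) ∈ ℤ³ : x+y+z even}`. -/
def fccD3 : Set (EuclideanSpace ℝ (Fin 3)) :=
  {v | ∃ a b c : ℤ, v 0 = a ∧ v 1 = b ∧ v 2 = c ∧ Even (a + b + c)}

/-- The body-centered cubic lattice `D₃* = ℤ³ ∪ ((1/2,1/2,1/2) + ℤ³)`. -/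
def bccD3star : Set (EuclideanSpace ℝ (Fin 3)) :=
  {v | (∃ a b c : ℤ, v 0 = a ∧ v 1 = b ∧ v 2 = c) ∨
       (∃ a b c : ℤ, v 0 - 1 / 2 = a ∧ v 1 - 1 / 2 = b ∧ v 2 - 1 / 2 = c)}

theorem sub_mem_bccD3star {u v : EuclideanSpace ℝ (Fin 3)} (hu : u ∈ bccD3star)
    (hv : v ∈ bccD3star) : u - v ∈ bccD3star := by
  rcases hu with ⟨a, b, c, ha, hb, hc⟩ | ⟨a, b, c, ha, hb, hc⟩ <;>
    rcases hv with ⟨a', b', c', ha', hb', hc'⟩ | ⟨a', b', c', ha', hb', hc'⟩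
  · refine Or.inl ⟨a - a', b - b', c - c', ?_, ?_, ?_⟩ <;>
      simp only [PiLp.sub_apply, Int.cast_sub] <;> linarith
  · refine Or.inr ⟨a - a' - 1, b - b' - 1, c - c' - 1, ?_, ?_, ?_⟩ <;>
      simp only [PiLp.sub_apply, Int.cast_sub, Int.cast_one] <;> linarith
  · refine Or.inr ⟨a - a', b - b', c - c', ?_, ?_, ?_⟩ <;>
      simp only [PiLp.sub_apply, Int.cast_sub] <;> linarith
  · refine Or.inl ⟨a - a', b - b', c - c', ?_, ?_, ?_⟩ <;>
      simp only [PiLp.sub_apply, Int.cast_sub] <;> linarith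

theorem even_sum_sq_iff (a b c : ℤ) : Even (a ^ 2 + b ^ 2 + c ^ 2) ↔ Even (a + b + c) := by
  simp [Int.even_add, Int.even_pow]

theorem exists_norm_sq_eq_of_mem_fccD3 {v : EuclideanSpace ℝ (Fin 3)} (hv : v ∈ fccD3) :
    ∃ k : ℤ, Even k ∧ ‖v‖ ^ 2 = k := by
  obtain ⟨a, b, c, ha, hb, hc, h⟩ := hv
  refine ⟨a ^ 2 + b ^ 2 + c ^ 2, (even_sum_sq_iff a b c).2 h, ?_⟩
  simp [EuclideanSpace.real_norm_sq_eq, Fin.sum_univ_three, ha, hb, hc]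

/-- Vectors of `D₃*` with even integral squared norm lie in `D₃`: those with half-odd coordinates
have squared norm in `3/4 + ℤ`. -/
theorem mem_fccD3_of_norm_sq_eq {v : EuclideanSpace ℝ (Fin 3)} (hv : v ∈ bccD3star) {k : ℤ}
    (hk : Even k) (h : ‖v‖ ^ 2 = k) : v ∈ fccD3 := by
  rw [EuclideanSpace.real_norm_sq_eq, Fin.sum_univ_three] at h
  rcases hv with ⟨a, b, c, ha, hb, hc⟩ | ⟨a, b, c, ha, hb, hc⟩
  · refine ⟨a, b, c, ha, hb, hc, (even_sum_sq_iff a b c).1 ?_⟩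
    rw [ha, hb, hc] at h
    have h' : a ^ 2 + b ^ 2 + c ^ 2 = k := by
      have : (a ^ 2 + b ^ 2 + c ^ 2 : ℝ) = k := h
      exact_mod_cast this
    rwa [h']
  · exfalso
    rw [sub_eq_iff_eq_add.1 ha, sub_eq_iff_eq_add.1 hb, sub_eq_iff_eq_add.1 hc] at h
    have h' : 4 * (a ^ 2 + a + b ^ 2 + b + c ^ 2 + c) + 3 = 4 * k := by
      have : (4 * (a ^ 2 + a + b ^ 2 + b + c ^ 2 + c) + 3 : ℝ) = 4 * k := by linarith
      exact_mod_cast this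
    omega

/-- Any bijective isometry of Euclidean 3-space mapping `D₃*` onto itself permutes
the cosets of `D₃` in `D₃*`: it preserves the relation `u − v ∈ D₃`. -/
theorem stmt10 (f : EuclideanSpace ℝ (Fin 3) ≃ᵢ EuclideanSpace ℝ (Fin 3))
    (hf : f '' bccD3star = bccD3star) :
    ∀ u ∈ bccD3star, ∀ v ∈ bccD3star, u - v ∈ fccD3 → f u - f v ∈ fccD3 := by
  intro u hu v hv huv
  obtain ⟨k, hk, h⟩ := exists_norm_sq_eq_of_mem_fccD3 huv
  have hmem : ∀ w ∈ bccD3star, f w ∈ bccD3star := fun w hw => hf ▸ Set.mem_image_of_mem f hw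
  refine mem_fccD3_of_norm_sq_eq (sub_mem_bccD3star (hmem u hu) (hmem v hv)) hk ?_
  rw [← h, ← dist_eq_norm, ← dist_eq_norm, f.dist_eq]
end
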